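/- Let L and M be finite-dimensional Lie algebras over the finite field F_q that are isoclinic. Then d(L) = d(M). -/

import Mathlib

/-- The commutativity degree of a finite Lie ring `L`:
the probability that two randomly chosen elements commute. -/
noncomputable def commDeg (L : Type*) [LieRing L] : ℚ :=
  (Nat.card {p : L × L // ⁅p.1, p.2⁆ = 0} : ℚ) / (Nat.card L : ℚ) ^ 2

/-- Two Lie algebras `L` and `M` over `F` are isoclinic if there are Lie algebra isomorphisms
`α : L/Z(L) ≃ M/Z(M)` and `β : L² ≃ M²` which are compatible with the brackets:
whenever `α (x + Z(L)) = u + Z(M)` and `α (y + Z(L)) = v + Z(M)` we have `β ⁅x, y⁆ = ⁅u, v⁆`. -/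
def IsIsoclinic (F : Type*) [Field F] (L M : Type*)
    [LieRing L] [LieAlgebra F L] [LieRing M] [LieAlgebra F M] : Prop :=
  ∃ (α : (L ⧸ LieAlgebra.center F L) ≃ₗ⁅F⁆ (M ⧸ LieAlgebra.center F M))
    (β : (⁅(⊤ : LieIdeal F L), (⊤ : LieIdeal F L)⁆ : LieIdeal F L) ≃ₗ⁅F⁆
         (⁅(⊤ : LieIdeal F M), (⊤ : LieIdeal F M)⁆ : LieIdeal F M)),
    ∀ (x y : L) (u v : M),
      α (LieSubmodule.Quotient.mk' (LieAlgebra.center F L) x) =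
        LieSubmodule.Quotient.mk' (LieAlgebra.center F M) u →
      α (LieSubmodule.Quotient.mk' (LieAlgebra.center F L) y) =
        LieSubmodule.Quotient.mk' (LieAlgebra.center F M) v →
      (β ⟨⁅x, y⁆, LieSubmodule.lie_mem_lie (LieSubmodule.mem_top x)
          (LieSubmodule.mem_top y)⟩ : M) = ⁅u, v⁆

/-- The preimage of a set under a surjective homomorphism `g` has size `#S * #ker g`. -/
theorem AddMonoidHom.card_subtype_comp {A B : Type*} [AddGroup A] [AddGroup B] (g : A →+ B)
    (hg : Function.Surjective g) (S : B → Prop) :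
    Nat.card {a // S (g a)} = Nat.card {b // S b} * Nat.card g.ker := by
  let s := Function.surjInv hg
  have hs : ∀ b, g (s b) = b := Function.surjInv_eq hg
  rw [← Nat.card_prod]
  exact Nat.card_congr
    { toFun := fun a ↦ (⟨g a.1, a.2⟩, ⟨a.1 - s (g a.1), by simp [AddMonoidHom.mem_ker, hs]⟩)
      invFun := fun p ↦ ⟨p.2.1 + s p.1.1, by
        have hp := p.2.2
        rw [AddMonoidHom.mem_ker] at hp
        simpa [hs, hp] using p.1.2⟩
      left_inv := fun a ↦ by simp
      right_inv := fun p ↦ by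
        have hp := p.2.2
        rw [AddMonoidHom.mem_ker] at hp
        ext <;> simp [hs, hp] }

/-- A surjective homomorphism of finite groups preserves the density of sets under preimage. -/
theorem AddMonoidHom.card_subtype_comp_div_card {A B : Type*} [AddGroup A] [AddGroup B] [Finite A]
    (g : A →+ B) (hg : Function.Surjective g) (S : B → Prop) :
    (Nat.card {a // S (g a)} : ℚ) / Nat.card A = (Nat.card {b // S b} : ℚ) / Nat.card B := by
  have hA : Nat.card A = Nat.card B * Nat.card g.ker := by
    simpa [Nat.card_congr (Equiv.Set.univ _)] using g.card_subtype_comp hg fun _ ↦ True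
  have hk : (Nat.card g.ker : ℚ) ≠ 0 := Nat.cast_ne_zero.mpr Nat.card_pos.ne'
  rw [g.card_subtype_comp hg, hA, Nat.cast_mul, Nat.cast_mul, mul_div_mul_right _ _ hk]

/-- If commutation in `L` is detected by a relation `P` on a quotient group `Q` of `L`, then the
commutativity degree of `L` is the density of `P`. -/
theorem commDeg_eq_card_div {L Q : Type*} [LieRing L] [Finite L] [AddGroup Q] (f : L →+ Q)
    (hf : Function.Surjective f) (P : Q → Q → Prop) (hP : ∀ x y, P (f x) (f y) ↔ ⁅x, y⁆ = 0) :
    commDeg L = (Nat.card {p : Q × Q // P p.1 p.2} : ℚ) / Nat.card (Q × Q) := by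
  rw [← (f.prodMap f).card_subtype_comp_div_card (hf.prodMap hf) fun p ↦ P p.1 p.2]
  simp [commDeg, hP, Nat.card_prod, sq]

/-- Isoclinic finite-dimensional Lie algebras over the finite field `F_q`
have the same commutativity degree. -/
theorem commDeg_eq_of_isIsoclinic
    (F : Type*) [Field F] [Fintype F]
    (L M : Type*) [LieRing L] [LieAlgebra F L] [Finite L]
    [LieRing M] [LieAlgebra F M] [Finite M]
    (h : IsIsoclinic F L M) :
    commDeg L = commDeg M := by
  obtain ⟨α, β, hαβ⟩ := h
  let π : M →+ M ⧸ LieAlgebra.center F M :=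
    (LieSubmodule.Quotient.mk' (LieAlgebra.center F M) : M →ₗ[F] _).toAddMonoidHom
  let ρ : L →+ M ⧸ LieAlgebra.center F M :=
    (α : (L ⧸ LieAlgebra.center F L) →ₗ[F] _).toAddMonoidHom.comp
      (LieSubmodule.Quotient.mk' (LieAlgebra.center F L) : L →ₗ[F] _).toAddMonoidHom
  have hπ : Function.Surjective π := LieSubmodule.Quotient.surjective_mk' _
  have hρ : Function.Surjective ρ :=
    α.surjective.comp (LieSubmodule.Quotient.surjective_mk' _)
  have key : ∀ (x y : L) (u v : M), ρ x = π u → ρ y = π v → (⁅u, v⁆ = 0 ↔ ⁅x, y⁆ = 0) := by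
    intro x y u v hx hy
    rw [← hαβ x y u v hx hy, ZeroMemClass.coe_eq_zero]
    exact (map_eq_zero_iff β β.injective).trans Subtype.ext_iff
  let s := Function.surjInv hπ
  have hs : ∀ b, π (s b) = b := Function.surjInv_eq hπ
  rw [commDeg_eq_card_div ρ hρ (fun a b ↦ ⁅s a, s b⁆ = 0)
      fun x y ↦ key x y _ _ (hs _).symm (hs _).symm,
    commDeg_eq_card_div π hπ (fun a b ↦ ⁅s a, s b⁆ = 0)]
  intro u v
  obtain ⟨x, hx⟩ := hρ (π u)
  obtain ⟨y, hy⟩ := hρ (π v)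
  rw [key x y u v hx hy]
  exact key x y _ _ (hx.trans (hs _).symm) (hy.trans (hs _).symm)
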